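/- Let G be a dynamic graph over a finite nonempty set V with a self-loop at every node in every round, with start rounds s_u and input values μ_u in a linearly ordered set 𝒱. If u ∈ Ker(G), then for every node v it holds that In^a_u(1:∞) ⊆ In^a_v(1:∞), and consequently m*_u = m*. -/

import Mathlib

open scoped Classical

section DynamicGraphs

variable {V : Type*}

/-- The product digraph `G(t:t')`: edge `(u,v)` iff there is a path
`w_t = u, …, w_{t'+1} = v` with `(w_k, w_{k+1})` an edge of `G(k)` for `t ≤ k ≤ t'`.
For `t' < t` it is the digraph with exactly a self-loop at each node. -/
def DProd (G : ℕ → V → V → Prop) (t t' : ℕ) (u v : V) : Prop :=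
  if t' < t then u = v
  else ∃ w : ℕ → V, w t = u ∧ w (t' + 1) = v ∧ ∀ k, t ≤ k → k ≤ t' → G k (w k) (w (k + 1))

/-- The integral `Ḡ`: `(u,v)` is an edge of `Ḡ(t)` iff it is an edge of `G(t:t')`
for some `t' ≥ t`. -/
def Integral (G : ℕ → V → V → Prop) (t : ℕ) (u v : V) : Prop :=
  ∃ t', t ≤ t' ∧ DProd G t t' u v

/-- The limit superior of a dynamic graph: edges occurring at infinitely many rounds. -/
def LimSupG (H : ℕ → V → V → Prop) (u v : V) : Prop :=
  ∀ t : ℕ, ∃ t', t ≤ t' ∧ H t' u v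

/-- `u` is a central root of the digraph `H`: `(u,v)` is an edge for every `v`. -/
def IsCRoot (H : V → V → Prop) (u : V) : Prop := ∀ v, H u v

/-- `u` is a root of the digraph `H`: every node is reachable from `u` by a path. -/
def IsRoot (H : V → V → Prop) (u : V) : Prop := ∀ v, Relation.ReflTransGen H u v

/-- The kernel of a dynamic graph: `Ker(G) = ∩_{t ≥ 1} CRoots(Ḡ(t))`. -/
def Ker (G : ℕ → V → V → Prop) : Set V :=
  {u | ∀ t, 1 ≤ t → IsCRoot (Integral G t) u}

/-- `G` is rooted with delay `T`: for every `t ≥ 1` the digraph `G(t : t+T-1)` is rooted. -/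
def RootedWithDelay (G : ℕ → V → V → Prop) (T : ℕ) : Prop :=
  ∀ t, 1 ≤ t → ∃ u, IsRoot (fun a b => DProd G t (t + T - 1) a b) u

/-- The active graph `G^a` for start rounds `s`: `(u,v)` is an edge iff `u = v`, or
`(u,v)` is an edge of `G(t)` and both `u` and `v` are active in round `t`. -/
def Ga (G : ℕ → V → V → Prop) (s : V → ℕ) (t : ℕ) (u v : V) : Prop :=
  u = v ∨ (G t u v ∧ s u ≤ t ∧ s v ≤ t)

lemma dprod_refl (H : ℕ → V → V → Prop) (hH : ∀ t u, H t u u) (t t' : ℕ) (u : V) :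
    DProd H t t' u u := by
  unfold DProd
  split
  · rfl
  · exact ⟨fun _ => u, rfl, rfl, fun k _ _ => hH k u⟩

lemma ga_refl (G : ℕ → V → V → Prop) (s : V → ℕ) : ∀ (t : ℕ) (u : V), Ga G s t u u :=
  fun _ u => Or.inl rfl

end DynamicGraphs

section Values

variable {V 𝒱 : Type*} [Fintype V] [LinearOrder 𝒱]

/-- `m_u(t) = min{μ_v : v ∈ In^a_u(1:t)}`. -/
noncomputable def mVal (G : ℕ → V → V → Prop) (s : V → ℕ) (μ : V → 𝒱) (u : V) (t : ℕ) : 𝒱 :=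
  (Finset.univ.filter fun v => DProd (Ga G s) 1 t v u).inf'
    ⟨u, Finset.mem_filter.mpr ⟨Finset.mem_univ u, dprod_refl (Ga G s) (ga_refl G s) 1 t u⟩⟩ μ

/-- `m*_u = min{μ_v : v ∈ In^a_u(1:∞)}`. -/
noncomputable def mStar (G : ℕ → V → V → Prop) (s : V → ℕ) (μ : V → 𝒱) (u : V) : 𝒱 :=
  (Finset.univ.filter fun v => ∃ t', 1 ≤ t' ∧ DProd (Ga G s) 1 t' v u).inf'
    ⟨u, Finset.mem_filter.mpr ⟨Finset.mem_univ u,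
      ⟨1, le_refl 1, dprod_refl (Ga G s) (ga_refl G s) 1 1 u⟩⟩⟩ μ

/-- `m* = max{m*_u : u ∈ V}`. -/
noncomputable def mStarMax [Nonempty V] (G : ℕ → V → V → Prop) (s : V → ℕ) (μ : V → 𝒱) : 𝒱 :=
  Finset.univ.sup' Finset.univ_nonempty (mStar G s μ)

/-- The MinMax output `y_u(t) = max{ m_v(θ_u(t)) : v ∈ In^a_u(θ_u(t)+1 : t) }`. -/
noncomputable def yVal (G : ℕ → V → V → Prop) (s : V → ℕ) (μ : V → 𝒱) (θ : V → ℕ → ℕ)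
    (u : V) (t : ℕ) : 𝒱 :=
  (Finset.univ.filter fun v => DProd (Ga G s) (θ u t + 1) t v u).sup'
    ⟨u, Finset.mem_filter.mpr
      ⟨Finset.mem_univ u, dprod_refl (Ga G s) (ga_refl G s) (θ u t + 1) t u⟩⟩
    (fun v => mVal G s μ v (θ u t))

/-- The cut-offs are safe: `θ_u(t) → ∞` and `t - θ_u(t) → ∞`. -/
def SafeCutoffs (θ : V → ℕ → ℕ) : Prop :=
  ∀ u : V, Filter.Tendsto (fun t => θ u t) Filter.atTop Filter.atTop ∧
    Filter.Tendsto (fun t => t - θ u t) Filter.atTop Filter.atTop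

end Values

section DynamicGraphs

variable {V : Type*}

lemma DProd.trans {H : ℕ → V → V → Prop} {a b c : ℕ} {x y z : V} (hab : a ≤ b + 1) (hbc : b ≤ c)
    (hxy : DProd H a b x y) (hyz : DProd H (b + 1) c y z) : DProd H a c x z := by
  rcases hab.eq_or_lt with rfl | hab
  · rw [DProd, if_pos (Nat.lt_succ_self b)] at hxy
    exact hxy ▸ hyz
  rcases hbc.eq_or_lt with rfl | hbc
  · rw [DProd, if_pos (Nat.lt_succ_self b)] at hyz
    exact hyz ▸ hxy
  rw [DProd, if_neg (by omega)] at hxy hyz ⊢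
  obtain ⟨p, rfl, rfl, hp⟩ := hxy
  obtain ⟨q, hqp, rfl, hq⟩ := hyz
  refine ⟨fun k => if k ≤ b + 1 then p k else q k, if_pos (by omega), if_neg (by omega), ?_⟩
  intro k hak hkc
  rcases lt_trichotomy k (b + 1) with hk | rfl | hk
  · simpa [show k ≤ b + 1 by omega, show k ≤ b by omega] using hp k hak (by omega)
  · simpa [hqp] using hq (b + 1) le_rfl hkc
  · simpa [show ¬ k ≤ b + 1 by omega, show ¬ k ≤ b by omega] using hq k (by omega) hkc

lemma DProd.mono {H K : ℕ → V → V → Prop} {a b : ℕ} {x y : V}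
    (h : ∀ t, a ≤ t → ∀ u v, H t u v → K t u v) (hxy : DProd H a b x y) : DProd K a b x y := by
  unfold DProd at hxy ⊢
  split_ifs at hxy ⊢
  · exact hxy
  · obtain ⟨p, hpa, hpb, hp⟩ := hxy
    exact ⟨p, hpa, hpb, fun k hak hkb => h k hak _ _ (hp k hak hkb)⟩

/-- A node of the kernel eventually passes on, in the active graph, whatever it has received. -/
lemma exists_dprod_ga_of_mem_ker [Finite V] {G : ℕ → V → V → Prop} {s : V → ℕ} {u : V}
    (hu : u ∈ Ker G) (v : V) {w : V} {t : ℕ} (ht : 1 ≤ t) (hwu : DProd (Ga G s) 1 t w u) :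
    ∃ t', 1 ≤ t' ∧ DProd (Ga G s) 1 t' w v := by
  obtain ⟨S, hS⟩ := (Set.finite_range s).bddAbove
  have hs : ∀ x, s x ≤ S := fun x => hS ⟨x, rfl⟩
  obtain ⟨t', ht', huv⟩ := hu (max t S + 1) (by omega) v
  have huv' : DProd (Ga G s) (max t S + 1) t' u v :=
    huv.mono fun k hk x y hxy =>
      Or.inr ⟨hxy, (hs x).trans (by omega), (hs y).trans (by omega)⟩
  have hwait : DProd (Ga G s) 1 (max t S) w u :=
    hwu.trans (by omega) (le_max_left t S) (dprod_refl _ (ga_refl G s) _ _ u)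
  exact ⟨t', by omega, hwait.trans (by omega) (by omega) huv'⟩

end DynamicGraphs

/-- if `u ∈ Ker(G)` then for every node `v`,
`In^a_u(1:∞) ⊆ In^a_v(1:∞)`, and `m*_u = m*`. -/
theorem kernel_node_min_is_max {V 𝒱 : Type*} [Fintype V] [Nonempty V] [LinearOrder 𝒱]
    (G : ℕ → V → V → Prop) (hloop : ∀ t u, G t u u)
    (s : V → ℕ) (hs : ∀ u, 1 ≤ s u) (μ : V → 𝒱)
    (u : V) (hu : u ∈ Ker G) :
    (∀ v w : V, (∃ t', 1 ≤ t' ∧ DProd (Ga G s) 1 t' w u) →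
        (∃ t', 1 ≤ t' ∧ DProd (Ga G s) 1 t' w v)) ∧
      mStar G s μ u = mStarMax G s μ := by
  have hsub : ∀ v w : V, (∃ t', 1 ≤ t' ∧ DProd (Ga G s) 1 t' w u) →
      (∃ t', 1 ≤ t' ∧ DProd (Ga G s) 1 t' w v) :=
    fun v _ ⟨_, ht, hwu⟩ => exists_dprod_ga_of_mem_ker hu v ht hwu
  refine ⟨hsub, le_antisymm (Finset.le_sup' (mStar G s μ) (Finset.mem_univ u)) ?_⟩
  exact Finset.sup'_le _ _ fun v _ =>
    Finset.inf'_mono μ (Finset.monotone_filter_right _ fun w _ => hsub v w) _
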